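/- Fix l ∈ ℕ. Let y_0, …, y_l be the l+1 distinct real roots of the orthonormal probabilists' Hermite polynomial H_{l+1}, and define the Gauss–Hermite weights w_k = 1/((l+1)² · H_l(y_k)²) for k = 0, …, l. Then Σ_{k=0}^{l} w_k e^{y_k²/4} ≤ √2. -/

import Mathlib

open MeasureTheory ProbabilityTheory

/-- The standard Gaussian probability measure `γ₁` on `ℝ`. -/
noncomputable def stdGaussian : Measure ℝ := gaussianReal 0 1

/-- The orthonormal probabilists' Hermite polynomial `H_n(x) = He_n(x)/√(n!)`. -/
noncomputable def Hnorm (n : ℕ) (x : ℝ) : ℝ :=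
  (Polynomial.aeval x (Polynomial.hermite n)) / Real.sqrt (Nat.factorial n)

/-- A family of univariate quadrature rules: at level `l`, `m l` nodes and weights. -/
structure QuadFamily where
  m : ℕ → ℕ
  node : ℕ → ℕ → ℝ
  weight : ℕ → ℕ → ℝ

variable {E : Type*} [NormedAddCommGroup E] [NormedSpace ℝ E]

/-- The univariate quadrature `Q_l(f) = Σ_k w_k^l f(y_k^l)`. -/
noncomputable def QuadFamily.quad (Q : QuadFamily) (l : ℕ) (f : ℝ → E) : E :=
  ∑ k ∈ Finset.range (Q.m l), Q.weight l k • f (Q.node l k)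

/-- Assumption A.1: `Q_l` integrates exactly every polynomial of degree `≤ l`
against the standard Gaussian measure. -/
def QuadFamily.ExactA1 (Q : QuadFamily) : Prop :=
  ∀ l : ℕ, ∀ p : Polynomial ℝ, p.natDegree ≤ l →
    Q.quad l (fun x => p.eval x) = ∫ x, p.eval x ∂stdGaussian

/-- Assumption A.2: `|Q_l(H_n)| < 2` for all levels `l` and degrees `n`. -/
def QuadFamily.BoundedA2 (Q : QuadFamily) : Prop :=
  ∀ l n : ℕ, |Q.quad l (Hnorm n)| < 2

/-- Tensor-product quadrature over the finite set `s` of dimensions, at levels `lev j`,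
applied to `f : ℝ^ℕ → E`, coordinates outside `s` being evaluated at `0`. -/
noncomputable def QuadFamily.tensor (Q : QuadFamily) (s : Finset ℕ) (lev : ℕ → ℕ)
    (f : (ℕ → ℝ) → E) : E :=
  ∑ k ∈ s.pi (fun j => Finset.range (Q.m (lev j))),
    (∏ j ∈ s.attach, Q.weight (lev j.1) (k j.1 j.2)) •
      f (fun j => if h : j ∈ s then Q.node (lev j) (k j h) else 0)

/-- The tensorized difference operator
`Δ_ν = ⊗_{j ∈ supp ν} (Q_{ν_j} - Q_{ν_j - 1})`, expanded as the alternating-sign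
sum over subsets `T ⊆ supp ν` of the tensor quadrature at levels `ν - 1_T`. -/
noncomputable def QuadFamily.delta (Q : QuadFamily) (ν : ℕ →₀ ℕ) (f : (ℕ → ℝ) → E) : E :=
  ∑ T ∈ ν.support.powerset, (-1 : ℝ) ^ T.card •
    Q.tensor ν.support (fun j => ν j - (if j ∈ T then 1 else 0)) f

/-- The sparse quadrature `Q_Λ(f) = Σ_{ν ∈ Λ} Δ_ν(f)`. -/
noncomputable def QuadFamily.sparse (Q : QuadFamily) (Λ : Finset (ℕ →₀ ℕ))
    (f : (ℕ → ℝ) → E) : E :=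
  ∑ ν ∈ Λ, Q.delta ν f

/-- The multivariate Hermite polynomial `H_ν(y) = ∏_{j ∈ supp ν} H_{ν_j}(y_j)`. -/
noncomputable def Hmulti (ν : ℕ →₀ ℕ) (y : ℕ → ℝ) : ℝ :=
  ∏ j ∈ ν.support, Hnorm (ν j) (y j)

/-- A set of multi-indices is downward closed (admissible). -/
def DownwardClosed (Λ : Set (ℕ →₀ ℕ)) : Prop :=
  ∀ ν ∈ Λ, ∀ μ : ℕ →₀ ℕ, μ ≤ ν → μ ∈ Λ

/-- `γ` is the countable product of standard Gaussian measures on `ℝ^ℕ`: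
a probability measure whose finite-dimensional marginals are products of `γ₁`. -/
def IsProductGaussian (γ : Measure (ℕ → ℝ)) : Prop :=
  IsProbabilityMeasure γ ∧
  ∀ n : ℕ, γ.map (fun y (i : Fin n) => y (i : ℕ)) =
    Measure.pi (fun _ : Fin n => stdGaussian)

/-- The weight `b_ν = ∏_j Σ_{l=0}^r binom(ν_j, l) τ_j^{2l}` (a finite product over `supp ν`). -/
noncomputable def bwt (r : ℕ) (τ : ℕ → ℝ) (ν : ℕ →₀ ℕ) : ℝ :=
  ∏ j ∈ ν.support, ∑ l ∈ Finset.range (r + 1), ((ν j).choose l : ℝ) * τ j ^ (2 * l)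

/-- The weight `c_ν = ∏_{j ∈ supp ν} (1 + ν_j)³`. -/
noncomputable def cwt (ν : ℕ →₀ ℕ) : ℝ :=
  ∏ j ∈ ν.support, ((1 : ℝ) + ν j) ^ 3

namespace GHaux

noncomputable def He (n : ℕ) (x : ℝ) : ℝ := Polynomial.aeval x (Polynomial.hermite n)

lemma deriv_hermite (n : ℕ) : Polynomial.derivative (Polynomial.hermite (n + 1)) =
    ((n : Polynomial ℤ) + 1) * Polynomial.hermite n := by
  induction n with
  | zero => simp
  | succ n ih =>
    rw [Polynomial.hermite_succ (n + 1), Polynomial.derivative_sub, Polynomial.derivative_mul, ih]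
    have h : Polynomial.derivative (((n : Polynomial ℤ) + 1) * Polynomial.hermite n)
        = ((n : Polynomial ℤ) + 1) * Polynomial.derivative (Polynomial.hermite n) := by
      simp [Polynomial.derivative_mul]
    rw [h, Polynomial.derivative_X, Polynomial.hermite_succ n]
    push_cast
    ring

lemma He_zero (x : ℝ) : He 0 x = 1 := by simp [He]

lemma He_one (x : ℝ) : He 1 x = x := by simp [He]

lemma He_rec (n : ℕ) (x : ℝ) : He (n + 2) x = x * He (n + 1) x - (n + 1) * He n x := by
  unfold He
  rw [Polynomial.hermite_succ (n + 1), deriv_hermite]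
  simp

lemma CD (l : ℕ) (x z : ℝ) :
    (∑ i ∈ Finset.range (l + 1), He i x * He i z / (i.factorial : ℝ)) * (x - z) =
      (He (l + 1) x * He l z - He l x * He (l + 1) z) / (l.factorial : ℝ) := by
  induction l with
  | zero => simp [He_zero, He_one]
  | succ l ih =>
    rw [Finset.sum_range_succ, add_mul, ih, He_rec, He_rec, Nat.factorial_succ]
    have : (l.factorial : ℝ) ≠ 0 := by positivity
    push_cast
    field_simp
    ring

lemma CDdiag (l : ℕ) (x : ℝ) :
    (∑ i ∈ Finset.range (l + 2), He i x * He i x / (i.factorial : ℝ)) =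
      ((l + 2) * He (l + 1) x ^ 2 - (l + 1) * He l x * He (l + 2) x) / ((l + 1).factorial : ℝ) := by
  induction l with
  | zero =>
    rw [He_rec]
    simp [Finset.sum_range_succ, He_zero, He_one]
    ring
  | succ l ih =>
    rw [Finset.sum_range_succ, ih, He_rec (l + 1), He_rec l, Nat.factorial_succ (l + 1),
      Nat.factorial_succ l]
    have : (l.factorial : ℝ) ≠ 0 := by positivity
    push_cast
    field_simp
    ring

lemma diag_root (l : ℕ) (x : ℝ) (h : He (l + 1) x = 0) :
    (∑ i ∈ Finset.range (l + 1), He i x * He i x / (i.factorial : ℝ)) =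
      (l + 1) * He l x ^ 2 / (l.factorial : ℝ) := by
  cases l with
  | zero => simp [He_zero]
  | succ l =>
    rw [CDdiag, h]
    push_cast
    ring

lemma diag_pos (l : ℕ) (x : ℝ) :
    0 < ∑ i ∈ Finset.range (l + 1), He i x * He i x / (i.factorial : ℝ) := by
  rw [Finset.sum_range_succ']
  have : 0 ≤ ∑ i ∈ Finset.range l, He (i+1) x * He (i+1) x / ((i+1).factorial : ℝ) :=
    Finset.sum_nonneg fun i _ => div_nonneg (mul_self_nonneg _) (by positivity)
  simp only [He_zero]
  norm_num
  linarith

noncomputable def mu : ℕ → ℝ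
  | 0 => 1
  | 1 => 0
  | (k + 2) => (k + 1) * mu k

lemma mu_nonneg : ∀ k, 0 ≤ mu k
  | 0 => by simp [mu]
  | 1 => by simp [mu]
  | (k + 2) => by
    have := mu_nonneg k
    rw [mu]; positivity

noncomputable def B (m i : ℕ) : ℝ := (m.descFactorial i : ℝ) * mu (m - i)

lemma B_nonneg (m i : ℕ) : 0 ≤ B m i := mul_nonneg (by positivity) (mu_nonneg _)

lemma B_zero_rec (m : ℕ) : B (m + 1) 0 = B m 1 := by
  cases m with
  | zero => simp [B, mu]
  | succ m => simp [B, mu]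

lemma B_succ_rec (m i : ℕ) : B (m + 1) (i + 1) = B m (i + 2) + (i + 1) * B m i := by
  unfold B
  have e : m + 1 - (i + 1) = m - i := by omega
  rw [e, Nat.succ_descFactorial_succ, Nat.descFactorial_succ m (i + 1), Nat.descFactorial_succ m i]
  rcases lt_trichotomy m i with h | h | h
  · simp [Nat.descFactorial_of_lt h]
  · subst h; simp; ring
  · obtain ⟨d, rfl⟩ := Nat.exists_eq_add_of_lt h
    have e1 : i + d + 1 - i = d + 1 := by omega
    have e2 : i + d + 1 - (i + 1) = d := by omega
    have e3 : i + d + 1 - (i + 2) = d - 1 := by omega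
    rw [e1, e2, e3]
    cases d with
    | zero => simp [mu]
    | succ d =>
      simp only [mu, Nat.add_sub_cancel]
      push_cast
      ring

lemma sum_mu_le (N : ℕ) :
    ∑ j ∈ Finset.range N, mu (2 * j) / (4 ^ j * (j.factorial : ℝ)) ≤ Real.sqrt 2 := by
  have key : ∀ j : ℕ, mu (2 * j) / (4 ^ j * (j.factorial : ℝ))
      = Ring.choose (-1/2 : ℝ) j * (-1/2) ^ j := by
    intro j
    induction j with
    | zero => simp [mu]
    | succ j ih =>
      have h1 := Ring.descPochhammer_eq_factorial_smul_choose (-1/2 : ℝ) (j + 1)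
      have h2 := Ring.descPochhammer_eq_factorial_smul_choose (-1/2 : ℝ) j
      rw [descPochhammer_succ_right] at h1
      simp only [Polynomial.smeval_mul, h2] at h1
      have hf : (j.factorial : ℝ) ≠ 0 := by positivity
      have h3 : ((j : ℝ) + 1) * Ring.choose (-1/2 : ℝ) (j + 1)
          = Ring.choose (-1/2 : ℝ) j * (-1/2 - j) := by
        simp [Polynomial.smeval_sub, Polynomial.smeval_natCast, Nat.factorial_succ] at h1
        apply mul_left_cancel₀ hf
        linarith
      have h4 : Ring.choose (-1/2 : ℝ) (j + 1)
          = Ring.choose (-1/2 : ℝ) j * (-1/2 - j) / ((j : ℝ) + 1) := by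
        rw [← h3]; field_simp
      have e : 2 * (j + 1) = 2 * j + 2 := by ring
      rw [h4, e, mu, Nat.factorial_succ, pow_succ, pow_succ]
      have : mu (2 * j) = Ring.choose (-1/2 : ℝ) j * (-1/2) ^ j * (4 ^ j * (j.factorial : ℝ)) := by
        rw [← ih]; field_simp
      rw [this]
      push_cast
      field_simp
      ring
  have hs := (Real.one_add_rpow_hasFPowerSeriesOnBall_zero (a := -1/2)).hasSum
    (y := (-1/2 : ℝ)) (by
      simp only [Metric.mem_eball, edist_zero_right]
      rw [← ofReal_norm, ENNReal.ofReal_lt_one]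
      norm_num)
  have hs' : HasSum (fun j => mu (2 * j) / (4 ^ j * (j.factorial : ℝ))) (Real.sqrt 2) := by
    have hfun : (fun j => mu (2 * j) / (4 ^ j * (j.factorial : ℝ))) =
        fun n => (binomialSeries ℝ (-1 / 2 : ℝ) n) fun _ => (-1 / 2 : ℝ) := by
      funext j
      rw [key, binomialSeries_apply]
      simp
    have hval : Real.sqrt 2 = (1 + (0 + (-1 / 2 : ℝ))) ^ (-1 / 2 : ℝ) := by
      rw [Real.sqrt_eq_rpow]
      have : (0 + (-1/2 : ℝ)) = -1/2 := by norm_num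
      rw [this, show (1 + -1/2 : ℝ) = 2⁻¹ by norm_num, Real.inv_rpow (by norm_num),
        ← Real.rpow_neg (by norm_num)]
      norm_num
    rw [hfun, hval]
    exact hs
  exact sum_le_hasSum _ (fun j _ => div_nonneg (mu_nonneg _) (by positivity)) hs'

lemma full (l : ℕ) (y : Fin (l + 1) → ℝ) (hy_inj : Function.Injective y)
    (hr : ∀ k, He (l + 1) (y k) = 0) (W : Fin (l + 1) → ℝ)
    (hW : ∀ k, W k * (∑ i ∈ Finset.range (l + 1), He i (y k) * He i (y k) / (i.factorial : ℝ)) = 1) :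
    ∑ k, W k * Real.exp ((y k) ^ 2 / 4) ≤ Real.sqrt 2 := by
  have base : ∀ i, i < l + 1 → ∑ k, W k * He i (y k) = if i = 0 then 1 else 0 := by
    let M : Matrix (Fin (l + 1)) (Fin (l + 1)) ℝ := fun i k => He i (y k)
    let P : Matrix (Fin (l + 1)) (Fin (l + 1)) ℝ :=
      fun k i => W k * He i (y k) / ((i : ℕ).factorial : ℝ)
    have hPM : P * M = 1 := by
      ext k k'
      have e : (P * M) k k' = W k *
          ∑ i ∈ Finset.range (l + 1), He i (y k) * He i (y k') / (i.factorial : ℝ) := by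
        rw [Matrix.mul_apply, Finset.mul_sum, Finset.sum_range]
        refine Finset.sum_congr rfl fun i _ => ?_
        simp only [P, M]
        ring
      rw [e]
      by_cases h : k = k'
      · subst h
        rw [hW, Matrix.one_apply_eq]
      · rw [Matrix.one_apply_ne h]
        have hc := CD l (y k) (y k')
        rw [hr, hr] at hc
        simp only [zero_mul, mul_zero, sub_zero, zero_div, mul_eq_zero] at hc
        rcases hc with hc | hc
        · rw [hc, mul_zero]
        · exact absurd (hy_inj (sub_eq_zero.mp hc)) h
    have hMP : M * P = 1 := mul_eq_one_comm.mp hPM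
    intro i hi
    have := congrFun (congrFun hMP ⟨i, hi⟩) 0
    rw [Matrix.mul_apply, Matrix.one_apply] at this
    simp only [M, P, Fin.ext_iff] at this
    simp only [Fin.val_zero, He_zero, Nat.factorial_zero, Nat.cast_one, div_one, mul_one] at this
    refine Eq.trans (Finset.sum_congr rfl fun k _ => mul_comm _ _) (this.trans ?_)
    by_cases h0 : i = 0 <;> simp [h0]
  have mom : ∀ m i, i ≤ l + 1 → ∑ k, W k * (y k ^ m * He i (y k)) ≤ B m i := by
    intro m
    induction m with
    | zero =>
      intro i hi
      rcases hi.lt_or_eq with h | h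
      · simp only [pow_zero, one_mul]
        rw [base i h]
        cases i <;> simp [B, mu]
      · subst h
        simp [hr, B_nonneg]
    | succ m ih =>
      intro i hi
      rcases hi.lt_or_eq with h | h
      · cases i with
        | zero =>
          rw [B_zero_rec]
          refine le_trans (le_of_eq ?_) (ih 1 (by omega))
          refine Finset.sum_congr rfl fun k _ => ?_
          rw [He_zero, He_one]; ring
        | succ i =>
          rw [B_succ_rec]
          have h1 := ih (i + 2) (by omega)
          have h2 := mul_le_mul_of_nonneg_left (ih i (by omega)) (by positivity : (0:ℝ) ≤ i + 1)
          refine le_trans (le_of_eq ?_) (add_le_add h1 h2)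
          rw [Finset.mul_sum, ← Finset.sum_add_distrib]
          refine Finset.sum_congr rfl fun k _ => ?_
          rw [He_rec]; ring
      · subst h
        simp [hr, B_nonneg]
  have part : ∀ N : ℕ, ∑ j ∈ Finset.range N,
      ∑ k, W k * ((y k ^ 2 / 4) ^ j / (j.factorial : ℝ)) ≤ Real.sqrt 2 := by
    intro N
    refine le_trans (Finset.sum_le_sum fun j _ => ?_) (sum_mu_le N)
    have h := mom (2 * j) 0 (by omega)
    simp only [He_zero, mul_one, B, Nat.descFactorial_zero, Nat.cast_one, one_mul,
      Nat.sub_zero] at h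
    refine le_trans (le_of_eq ?_) (div_le_div_of_nonneg_right h
      (by positivity : (0:ℝ) ≤ 4 ^ j * (j.factorial : ℝ)))
    rw [Finset.sum_div]
    refine Finset.sum_congr rfl fun k _ => ?_
    rw [div_pow, ← pow_mul, div_div, mul_div_assoc]
  have hsum : HasSum (fun j : ℕ => ∑ k, W k * ((y k ^ 2 / 4) ^ j / (j.factorial : ℝ)))
      (∑ k, W k * Real.exp ((y k) ^ 2 / 4)) := by
    refine hasSum_sum fun k _ => HasSum.mul_left _ ?_
    have := NormedSpace.expSeries_div_hasSum_exp (y k ^ 2 / 4 : ℝ)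
    rwa [← Real.exp_eq_exp_ℝ] at this
  exact le_of_tendsto' hsum.tendsto_sum_nat part

end GHaux

/-- The `(l+1)`-point Gauss–Hermite quadrature of `e^{x²/4}` is at most `√2`. -/
theorem gaussHermite_quad_exp_le_sqrt_two (l : ℕ) (y : Fin (l + 1) → ℝ)
    (hy_inj : Function.Injective y)
    (hy_root : ∀ k, Hnorm (l + 1) (y k) = 0)
    (w : Fin (l + 1) → ℝ)
    (hw : ∀ k, w k = 1 / (((l : ℝ) + 1) ^ 2 * (Hnorm l (y k)) ^ 2)) :
    ∑ k, w k * Real.exp ((y k) ^ 2 / 4) ≤ Real.sqrt 2 := by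
  have hr : ∀ k, GHaux.He (l + 1) (y k) = 0 := by
    intro k
    have := hy_root k
    unfold Hnorm at this
    rcases div_eq_zero_iff.mp this with h | h
    · exact h
    · exact absurd h (by positivity)
  have hd := fun k => GHaux.diag_root l (y k) (hr k)
  have hp := fun k => GHaux.diag_pos l (y k)
  have hfull := GHaux.full l y hy_inj hr
    (fun k => (∑ i ∈ Finset.range (l + 1),
      GHaux.He i (y k) * GHaux.He i (y k) / (i.factorial : ℝ))⁻¹)
    (fun k => inv_mul_cancel₀ (hp k).ne')
  refine le_trans (Finset.sum_le_sum fun k _ => ?_) hfull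
  refine mul_le_mul_of_nonneg_right ?_ (Real.exp_pos _).le
  have hp' := hp k
  rw [hd k] at hp' ⊢
  have hH : Hnorm l (y k) ^ 2 = GHaux.He l (y k) ^ 2 / (l.factorial : ℝ) := by
    unfold Hnorm GHaux.He
    rw [div_pow, Real.sq_sqrt (by positivity)]
  rw [hw k, hH, one_div]
  apply inv_anti₀ hp'
  have h0 : 0 ≤ GHaux.He l (y k) ^ 2 / (l.factorial : ℝ) := by positivity
  have hl : (0 : ℝ) ≤ l := by positivity
  rw [mul_div_assoc]
  refine mul_le_mul_of_nonneg_right ?_ h0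
  nlinarith
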